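/- Let G be a bridgeless cubic graph with a 2-factor F and complementary perfect matching M, and let C*_6 denote the set of induced chordless 6-circuits with independent boundary, all of whose boundary edges lie in F, and which do not touch any induced 4- or 5-circuit. Then any circuit in C*_6 intersects at most 4 other circuits in C*_6, there are no 5 pairwise intersecting circuits in C*_6, and consequently there is a subfamily of pairwise disjoint circuits of size at least |C*_6|/4. -/

import Mathlib

open SimpleGraph

variable {V : Type*}

noncomputable def deg (F : SimpleGraph V) (v : V) : ℕ := Nat.card (F.neighborSet v)

def IsCubic (G : SimpleGraph V) : Prop := ∀ v, deg G v = 3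

def Bridgeless (G : SimpleGraph V) : Prop := ∀ e : Sym2 V, ¬ G.IsBridge e

def IsEvenFactor (G F : SimpleGraph V) : Prop := F ≤ G ∧ ∀ v, deg F v = 0 ∨ deg F v = 2

def Is2Factor (G F : SimpleGraph V) : Prop := F ≤ G ∧ ∀ v, deg F v = 2

noncomputable def numIso (F : SimpleGraph V) : ℕ := Nat.card {v : V // deg F v = 0}

def IsCircuitOf (F : SimpleGraph V) (C : Set V) : Prop :=
  ∃ v, deg F v ≠ 0 ∧ C = {u | F.Reachable v u}

noncomputable def numCirc (F : SimpleGraph V) : ℕ := Nat.card {C : Set V // IsCircuitOf F C}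

noncomputable def cost [Fintype V] (F : SimpleGraph V) : ℝ :=
  (Fintype.card V : ℝ) + 2 * (numCirc F : ℝ) + (numIso F : ℝ)

def bdry (G : SimpleGraph V) (S : Set V) : Set (Sym2 V) :=
  {e | ∃ u v, e = s(u, v) ∧ G.Adj u v ∧ u ∈ S ∧ v ∉ S}

noncomputable def bdryCard (G : SimpleGraph V) (S : Set V) : ℕ := Nat.card ↥(bdry G S)

noncomputable def bdryCount (G F : SimpleGraph V) (S : Set V) : ℕ :=
  Nat.card ↥(bdry G S ∩ F.edgeSet)


def IndepBoundary (G : SimpleGraph V) (S : Set V) : Prop :=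
  (bdry G S).Pairwise fun e f => ∀ v : V, v ∈ e → v ∉ f

def HasSpanningCycle (G : SimpleGraph V) (S : Set V) : Prop :=
  ∃ (a : V) (w : G.Walk a a), w.IsCycle ∧ ∀ v : V, v ∈ w.support ↔ v ∈ S

noncomputable def inducedEdges (G : SimpleGraph V) (S : Set V) : ℕ :=
  Nat.card {e : Sym2 V // e ∈ G.edgeSet ∧ ∀ v ∈ e, v ∈ S}

def IsInducedCircuit (G : SimpleGraph V) (S : Set V) (k : ℕ) : Prop :=
  HasSpanningCycle G S ∧ Nat.card S = k ∧ inducedEdges G S = k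

def Touches (A B : Set V) : Prop := (A ∩ B).Nonempty ∧ (A \ B).Nonempty

def IsDiamond8 (G : SimpleGraph V) (S : Set V) : Prop :=
  HasSpanningCycle G S ∧ Nat.card S = 8 ∧ inducedEdges G S = 11

def IsDiamond6 (G : SimpleGraph V) (S : Set V) : Prop :=
  HasSpanningCycle G S ∧ Nat.card S = 6 ∧ inducedEdges G S = 8 ∧
    ¬ ∃ T, IsDiamond8 G T ∧ S ⊆ T

def IsDiamond4 (G : SimpleGraph V) (S : Set V) : Prop :=
  HasSpanningCycle G S ∧ Nat.card S = 4 ∧ inducedEdges G S = 5 ∧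
    ¬ ∃ T, IsDiamond6 G T ∧ S ⊆ T

def HasTriangleIn (G : SimpleGraph V) (S : Set V) : Prop :=
  ∃ a b c, a ∈ S ∧ b ∈ S ∧ c ∈ S ∧ G.Adj a b ∧ G.Adj b c ∧ G.Adj a c

def Type1Red (G : SimpleGraph V) (S : Set V) : Prop :=
  HasSpanningCycle G S ∧ Nat.card S = 5 ∧ inducedEdges G S = 6 ∧ IndepBoundary G S

def Type3Red (G : SimpleGraph V) (S : Set V) : Prop :=
  HasSpanningCycle G S ∧ Nat.card S = 7 ∧ inducedEdges G S = 9 ∧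
    (∃ D, IsDiamond4 G D ∧ D ⊆ S) ∧ IndepBoundary G S

def Type4Red (G : SimpleGraph V) (S : Set V) : Prop :=
  HasSpanningCycle G S ∧ Nat.card S = 6 ∧ inducedEdges G S = 7 ∧ HasTriangleIn G S

def IrreducibleGraph (G : SimpleGraph V) : Prop :=
  ¬ ∃ S : Set V, Type1Red G S ∨ IsDiamond8 G S ∨ Type3Red G S ∨ Type4Red G S

def InCstar (G : SimpleGraph V) (T : Set V) : Prop :=
  IsInducedCircuit G T 4 ∨ IsInducedCircuit G T 5

def C4coll (G : SimpleGraph V) : Set (Set V) :=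
  {S | IsInducedCircuit G S 4 ∧ IndepBoundary G S}

def C5coll (G : SimpleGraph V) : Set (Set V) :=
  {S | IsInducedCircuit G S 5 ∧ IndepBoundary G S}

def C6coll (G : SimpleGraph V) : Set (Set V) :=
  {S | IsInducedCircuit G S 6 ∧ IndepBoundary G S}

def NoTouchCstar (G : SimpleGraph V) (S : Set V) : Prop :=
  ¬ ∃ T, InCstar G T ∧ Touches S T

def C4noint (G : SimpleGraph V) : Set (Set V) := {S | S ∈ C4coll G ∧ NoTouchCstar G S}
def C5noint (G : SimpleGraph V) : Set (Set V) := {S | S ∈ C5coll G ∧ NoTouchCstar G S}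
def C6noint (G : SimpleGraph V) : Set (Set V) := {S | S ∈ C6coll G ∧ NoTouchCstar G S}

def C44noint (G : SimpleGraph V) : Set (Set V) :=
  {S | HasSpanningCycle G S ∧ Nat.card S = 6 ∧ inducedEdges G S = 7 ∧
       ¬ HasTriangleIn G S ∧ NoTouchCstar G S}

def C4int5 (G : SimpleGraph V) : Set (Set V) :=
  {S | S ∈ C4coll G ∧ (∃ T, IsInducedCircuit G T 5 ∧ Touches S T) ∧
       ¬ ∃ T, (IsInducedCircuit G T 4 ∨ IsInducedCircuit G T 6) ∧ Touches S T}

def D4coll (G : SimpleGraph V) : Set (Set V) := {S | IsDiamond4 G S}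
def D6coll (G : SimpleGraph V) : Set (Set V) := {S | IsDiamond6 G S}

/-- `C*₆`: the induced chordless 6-circuits with independent boundary, not touching any
induced 4- or 5-circuit, all of whose (six) boundary edges lie in the 2-factor `F`. -/
def Cstar6F (G F : SimpleGraph V) : Set (Set V) :=
  {S | S ∈ C6noint G ∧ bdryCount G F S = 6}


/-- `C` is the hexagon `x, m x, y, m y, z, m z`, alternating between `m`-edges and `F`-edges. -/
structure IsHexagon (F : SimpleGraph V) (m : V → V) (C : Set V) (x y z : V) : Prop where
  eq : C = {x, m x, y, m y, z, m z}
  nodup : [x, m x, y, m y, z, m z].Nodup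
  adj_xy : F.Adj (m x) y
  adj_yz : F.Adj (m y) z
  adj_zx : F.Adj (m z) x

/-- A family of hexagons alternating between a perfect matching `m` and a graph `F` of maximum
degree two, each with independent boundary and meeting no square in an `F`-edge. -/
structure IsHexagonFamily (F : SimpleGraph V) (m : V → V) (𝒞 : Set (Set V)) : Prop where
  invol : ∀ v, m (m v) = v
  eq_of_adj : ∀ {v a b c}, F.Adj v a → F.Adj v b → F.Adj v c → b ≠ a → c ≠ a → b = c
  partner_mem : ∀ {S}, S ∈ 𝒞 → ∀ {v}, v ∈ S → m v ∈ S
  inner : ∀ {S}, S ∈ 𝒞 → ∀ {v a b}, v ∈ S → a ∈ S → b ∈ S → F.Adj v a → F.Adj v b → a = b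
  outer : ∀ {S}, S ∈ 𝒞 → ∀ {u v w}, u ∈ S → v ∈ S → w ∉ S → F.Adj u w → F.Adj v w → u = v
  no_square : ∀ {S}, S ∈ 𝒞 → ∀ {u v u' v'}, u ∈ S → v ∈ S → u' ∉ S → v' ∉ S →
    F.Adj u v → F.Adj u u' → F.Adj v v' → ¬ F.Adj u' v'
  hexagon : ∀ {S}, S ∈ 𝒞 → ∀ {v}, v ∈ S → ∃ y z, IsHexagon F m S v y z

section Hexagons

variable {F : SimpleGraph V} {m : V → V} {𝒞 : Set (Set V)} {C D D' E : Set V} {x y z : V}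

namespace IsHexagon

lemma rotate (h : IsHexagon F m C x y z) : IsHexagon F m C y z x where
  eq := by
    rw [h.eq]
    ext v
    simp only [Set.mem_insert_iff, Set.mem_singleton_iff]
    tauto
  nodup := by
    have := h.nodup
    simp only [List.nodup_cons, List.mem_cons, List.not_mem_nil, not_or] at this ⊢
    grind
  adj_xy := h.adj_yz
  adj_yz := h.adj_zx
  adj_zx := h.adj_xy

lemma mem_left (h : IsHexagon F m C x y z) : x ∈ C := by simp [h.eq]

lemma mem_mid (h : IsHexagon F m C x y z) : y ∈ C := h.rotate.mem_left

lemma mem_right (h : IsHexagon F m C x y z) : z ∈ C := h.rotate.rotate.mem_left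

end IsHexagon

namespace IsHexagonFamily

lemma partner_mem_iff (h : IsHexagonFamily F m 𝒞) (hC : C ∈ 𝒞) {v : V} : m v ∈ C ↔ v ∈ C :=
  ⟨fun hv => by simpa [h.invol] using h.partner_mem hC hv, h.partner_mem hC⟩

/-- A second hexagon sharing an `F`-edge with `C` shares exactly four vertices with `C`. -/
lemma exists_of_two_mem (h : IsHexagonFamily F m 𝒞) (hC : C ∈ 𝒞) (hx : IsHexagon F m C x y z)
    (hD : D ∈ 𝒞) (hne : D ≠ C) (hxD : x ∈ D) (hyD : y ∈ D) :
    ∃ w, IsHexagon F m D x y w ∧ z ∉ D ∧ w ∉ C := by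
  obtain ⟨p, w, hp⟩ := h.hexagon hD hxD
  obtain rfl : p = y :=
    h.inner hD ((h.partner_mem_iff hD).2 hxD) hp.mem_mid hyD hp.adj_xy hx.adj_xy
  have hwz : w ≠ z := by
    rintro rfl
    exact hne (hp.eq.trans hx.eq.symm)
  refine ⟨w, hp, fun hz => hwz ?_, fun hw => hwz ?_⟩
  · exact h.inner hD ((h.partner_mem_iff hD).2 hyD) hp.mem_right hz hp.adj_yz hx.adj_yz
  · exact h.inner hC ((h.partner_mem_iff hC).2 hx.mem_mid) hw hx.mem_right hp.adj_yz hx.adj_yz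

lemma eq_of_two_mem (h : IsHexagonFamily F m 𝒞) (hC : C ∈ 𝒞) (hx : IsHexagon F m C x y z)
    (hD : D ∈ 𝒞) (hne : D ≠ C) (hxD : x ∈ D) (hyD : y ∈ D)
    (hD' : D' ∈ 𝒞) (hne' : D' ≠ C) (hxD' : x ∈ D') (hyD' : y ∈ D') : D = D' := by
  obtain ⟨w, hw, -, hwC⟩ := h.exists_of_two_mem hC hx hD hne hxD hyD
  obtain ⟨w', hw', -, hwC'⟩ := h.exists_of_two_mem hC hx hD' hne' hxD' hyD'
  have hz := hx.mem_right
  obtain rfl : w = w' := h.eq_of_adj hx.adj_yz hw.adj_yz hw'.adj_yz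
    (fun e => hwC (e ▸ hz)) (fun e => hwC' (e ▸ hz))
  exact hw.eq.trans hw'.eq.symm

lemma eq_of_one_mem (h : IsHexagonFamily F m 𝒞) (hx : IsHexagon F m C x y z)
    (hD : D ∈ 𝒞) (hxD : x ∈ D) (hyD : y ∉ D) (hzD : z ∉ D)
    (hD' : D' ∈ 𝒞) (hxD' : x ∈ D') (hyD' : y ∉ D') (hzD' : z ∉ D') : D = D' := by
  obtain ⟨p, q, hp⟩ := h.hexagon hD hxD
  obtain ⟨p', q', hp'⟩ := h.hexagon hD' hxD'
  obtain rfl : p = p' := h.eq_of_adj hx.adj_xy hp.adj_xy hp'.adj_xy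
    (fun e => hyD (e ▸ hp.mem_mid)) (fun e => hyD' (e ▸ hp'.mem_mid))
  have hq : m q = m q' := h.eq_of_adj hx.adj_zx.symm hp.adj_zx.symm hp'.adj_zx.symm
    (fun e => hzD ((h.partner_mem_iff hD).1 (e ▸ h.partner_mem hD hp.mem_right)))
    (fun e => hzD' ((h.partner_mem_iff hD').1 (e ▸ h.partner_mem hD' hp'.mem_right)))
  obtain rfl : q = q' := by simpa [h.invol] using congrArg m hq
  exact hp.eq.trans hp'.eq.symm

/-- If hexagons share the `F`-edges of `C` on both sides of the matching edge at `y`, then no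
hexagon meets `C` in that matching edge only. -/
lemma not_one_mem_of_two_mem (h : IsHexagonFamily F m 𝒞) (hC : C ∈ 𝒞)
    (hx : IsHexagon F m C x y z)
    (hD : D ∈ 𝒞) (hne : D ≠ C) (hxD : x ∈ D) (hyD : y ∈ D)
    (hD' : D' ∈ 𝒞) (hne' : D' ≠ C) (hyD' : y ∈ D') (hzD' : z ∈ D')
    (hE : E ∈ 𝒞) (hxE : x ∉ E) (hyE : y ∈ E) (hzE : z ∉ E) : False := by
  obtain ⟨w, hw, hzD, hwC⟩ := h.exists_of_two_mem hC hx hD hne hxD hyD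
  obtain ⟨w', hw', hxD', hwC'⟩ := h.exists_of_two_mem hC hx.rotate hD' hne' hyD' hzD'
  obtain ⟨p, q, hp⟩ := h.hexagon hE hyE
  obtain rfl : p = w := h.eq_of_adj hx.adj_yz hp.adj_xy hw.adj_yz
    (fun e => hzE (e ▸ hp.mem_mid)) (fun e => hwC (e ▸ hx.mem_right))
  have hq : m q = m w' := h.eq_of_adj hx.adj_xy.symm hp.adj_zx.symm hw'.adj_zx.symm
    (fun e => hxE ((h.partner_mem_iff hE).1 (e ▸ h.partner_mem hE hp.mem_right)))
    (fun e => hxD' ((h.partner_mem_iff hD').1 (e ▸ h.partner_mem hD' hw'.mem_right)))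
  obtain rfl : q = w' := by simpa [h.invol] using congrArg m hq
  exact h.no_square hC hx.mem_left (h.partner_mem hC hx.mem_right)
    (fun hh => hwC ((h.partner_mem_iff hC).1 hh)) hwC' hx.adj_zx.symm hw.adj_zx.symm hw'.adj_yz
    hp.adj_yz

/-- A hexagon sharing an `F`-edge with `C` is disjoint from one meeting `C` in the opposite
matching edge only. -/
lemma disjoint_of_complementary (h : IsHexagonFamily F m 𝒞) (hC : C ∈ 𝒞)
    (hx : IsHexagon F m C x y z)
    (hD : D ∈ 𝒞) (hne : D ≠ C) (hxD : x ∈ D) (hyD : y ∈ D)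
    (hE : E ∈ 𝒞) (hxE : x ∉ E) (hyE : y ∉ E) (hzE : z ∈ E) : Disjoint D E := by
  obtain ⟨w, hw, hzD, hwC⟩ := h.exists_of_two_mem hC hx hD hne hxD hyD
  have hmwC : m w ∉ C := fun hh => hwC ((h.partner_mem_iff hC).1 hh)
  obtain ⟨p, q, hp⟩ := h.hexagon hE hzE
  have hwE : w ∉ E := by
    intro hwE
    rw [hp.eq] at hwE
    have hnd := hx.nodup
    simp only [List.nodup_cons, List.mem_cons, List.not_mem_nil, not_or] at hnd
    have hxC := hx.mem_left
    have hzC := hx.mem_right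
    have hmyC := h.partner_mem hC hx.mem_mid
    have hmzC := h.partner_mem hC hx.mem_right
    simp only [Set.mem_insert_iff, Set.mem_singleton_iff] at hwE
    rcases hwE with rfl | rfl | rfl | rfl | rfl | rfl
    · exact hwC hzC
    · exact hwC hmzC
    · have := h.outer hC hmyC hmzC hwC hw.adj_yz hp.adj_xy
      grind
    · rw [h.invol] at hmwC
      have := h.outer hC hxC hmzC hmwC (by simpa [h.invol] using hw.adj_zx.symm) hp.adj_xy
      grind
    · have := h.outer hC hxC hzC hmwC hw.adj_zx.symm hp.adj_zx.symm
      grind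
    · have := h.outer hC hmyC hzC hwC hw.adj_yz hp.adj_zx.symm
      grind
  rw [Set.disjoint_left]
  intro v hv
  rw [hw.eq] at hv
  simp only [Set.mem_insert_iff, Set.mem_singleton_iff] at hv
  rcases hv with rfl | rfl | rfl | rfl | rfl | rfl
  all_goals simpa only [h.partner_mem_iff hE]

end IsHexagonFamily

open Classical in
/-- Which of the three matching edges of a hexagon the set `D` contains. -/
noncomputable def pattern (x y z : V) (D : Set V) : Bool × Bool × Bool :=
  (decide (x ∈ D), decide (y ∈ D), decide (z ∈ D))

/-- The constraints on the set of patterns of the hexagons meeting a given hexagon. -/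
def Admissible (P : Finset (Bool × Bool × Bool)) : Prop :=
  (false, false, false) ∉ P ∧ (true, true, true) ∉ P ∧
  ¬ ((true, true, false) ∈ P ∧ (false, true, true) ∈ P ∧ (false, true, false) ∈ P) ∧
  ¬ ((false, true, true) ∈ P ∧ (true, false, true) ∈ P ∧ (false, false, true) ∈ P) ∧
  ¬ ((true, false, true) ∈ P ∧ (true, true, false) ∈ P ∧ (true, false, false) ∈ P)

instance : DecidablePred Admissible := fun P => by unfold Admissible; infer_instance

lemma Admissible.card_le_four : ∀ P, Admissible P → P.card ≤ 4 := by decide +kernel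

lemma Admissible.card_le_three : ∀ P, Admissible P → (true, true, false) ∈ P →
    (false, true, true) ∈ P → (true, false, true) ∈ P → P.card ≤ 3 := by decide +kernel

lemma Admissible.card_le_three_of_no_complement : ∀ P, Admissible P →
    ¬ ((true, true, false) ∈ P ∧ (false, false, true) ∈ P) →
    ¬ ((false, true, true) ∈ P ∧ (true, false, false) ∈ P) →
    ¬ ((true, false, true) ∈ P ∧ (false, true, false) ∈ P) → P.card ≤ 3 := by decide +kernel

set_option synthInstance.maxSize 1000 in
lemma Admissible.cases_of_four_le_card : ∀ P, Admissible P → 4 ≤ P.card →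
    ((true, true, false) ∈ P ∧ (true, false, false) ∈ P ∧ (false, true, false) ∈ P) ∨
    ((false, true, true) ∈ P ∧ (false, true, false) ∈ P ∧ (false, false, true) ∈ P) ∨
    ((true, false, true) ∈ P ∧ (false, false, true) ∈ P ∧ (true, false, false) ∈ P) ∨
    ((true, true, false) ∈ P ∧ (false, true, true) ∈ P ∧ (false, false, true) ∈ P) ∨
    ((false, true, true) ∈ P ∧ (true, false, true) ∈ P ∧ (true, false, false) ∈ P) ∨
    ((true, false, true) ∈ P ∧ (true, true, false) ∈ P ∧ (false, true, false) ∈ P) := by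
  decide +kernel

/-- `D` is a member of `𝒞` other than `C` that intersects `C`. -/
def IsNeighbor (𝒞 : Set (Set V)) (C D : Set V) : Prop := D ∈ 𝒞 ∧ D ≠ C ∧ (D ∩ C).Nonempty

open Classical in
lemma mem_image_pattern {N : Finset (Set V)} {p q r : Bool} :
    (p, q, r) ∈ N.image (pattern x y z) ↔
      ∃ D ∈ N, (x ∈ D ↔ p = true) ∧ (y ∈ D ↔ q = true) ∧ (z ∈ D ↔ r = true) := by
  simp only [Finset.mem_image, pattern, Prod.mk.injEq]
  refine exists_congr fun D => and_congr_right fun _ => ?_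
  cases p <;> cases q <;> cases r <;> simp

namespace IsHexagonFamily

lemma exists_mem_of_neighbor (h : IsHexagonFamily F m 𝒞) (hx : IsHexagon F m C x y z)
    (hD : IsNeighbor 𝒞 C D) : x ∈ D ∨ y ∈ D ∨ z ∈ D := by
  obtain ⟨v, hvD, hvC⟩ := hD.2.2
  rw [hx.eq] at hvC
  simp only [Set.mem_insert_iff, Set.mem_singleton_iff] at hvC
  have key := fun v => h.partner_mem_iff hD.1 (v := v)
  rcases hvC with rfl | rfl | rfl | rfl | rfl | rfl <;> grind

lemma not_all_mem_of_neighbor (h : IsHexagonFamily F m 𝒞) (hC : C ∈ 𝒞)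
    (hx : IsHexagon F m C x y z) (hD : IsNeighbor 𝒞 C D) : ¬ (x ∈ D ∧ y ∈ D ∧ z ∈ D) := by
  rintro ⟨hxD, hyD, hzD⟩
  obtain ⟨w, -, hz, -⟩ := h.exists_of_two_mem hC hx hD.1 hD.2.1 hxD hyD
  exact hz hzD

lemma pattern_injOn (h : IsHexagonFamily F m 𝒞) (hC : C ∈ 𝒞) (hx : IsHexagon F m C x y z) :
    Set.InjOn (pattern x y z) {D | IsNeighbor 𝒞 C D} := by
  intro D hD D' hD' heq
  simp only [pattern, Prod.mk.injEq, decide_eq_decide] at heq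
  obtain ⟨ex, ey, ez⟩ := heq
  have hor := h.exists_mem_of_neighbor hx hD
  have hnot := h.not_all_mem_of_neighbor hC hx hD
  by_cases hxD : x ∈ D <;> by_cases hyD : y ∈ D <;> by_cases hzD : z ∈ D
  · exact absurd ⟨hxD, hyD, hzD⟩ hnot
  · exact h.eq_of_two_mem hC hx hD.1 hD.2.1 hxD hyD hD'.1 hD'.2.1 (ex.1 hxD) (ey.1 hyD)
  · exact h.eq_of_two_mem hC hx.rotate.rotate hD.1 hD.2.1 hzD hxD hD'.1 hD'.2.1
      (ez.1 hzD) (ex.1 hxD)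
  · exact h.eq_of_one_mem hx hD.1 hxD hyD hzD hD'.1 (ex.1 hxD) (mt ey.2 hyD) (mt ez.2 hzD)
  · exact h.eq_of_two_mem hC hx.rotate hD.1 hD.2.1 hyD hzD hD'.1 hD'.2.1 (ey.1 hyD) (ez.1 hzD)
  · exact h.eq_of_one_mem hx.rotate hD.1 hyD hzD hxD hD'.1 (ey.1 hyD) (mt ez.2 hzD) (mt ex.2 hxD)
  · exact h.eq_of_one_mem hx.rotate.rotate hD.1 hzD hxD hyD hD'.1 (ez.1 hzD) (mt ex.2 hxD)
      (mt ey.2 hyD)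
  · exact absurd hor (by tauto)

open Classical in
lemma card_image_pattern (h : IsHexagonFamily F m 𝒞) (hC : C ∈ 𝒞) (hx : IsHexagon F m C x y z)
    {N : Finset (Set V)} (hN : ∀ D ∈ N, IsNeighbor 𝒞 C D) :
    (N.image (pattern x y z)).card = N.card :=
  Finset.card_image_of_injOn fun D hD D' hD' => h.pattern_injOn hC hx (hN D hD) (hN D' hD')

open Classical in
lemma admissible_image_pattern (h : IsHexagonFamily F m 𝒞) (hC : C ∈ 𝒞)
    (hx : IsHexagon F m C x y z) {N : Finset (Set V)} (hN : ∀ D ∈ N, IsNeighbor 𝒞 C D) :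
    Admissible (N.image (pattern x y z)) := by
  simp only [Admissible, mem_image_pattern, Bool.false_eq_true, iff_false, iff_true]
  refine ⟨?_, ?_, ?_, ?_, ?_⟩
  · rintro ⟨D, hD, h1, h2, h3⟩
    have := h.exists_mem_of_neighbor hx (hN D hD)
    tauto
  · rintro ⟨D, hD, h1⟩
    exact h.not_all_mem_of_neighbor hC hx (hN D hD) h1
  · rintro ⟨⟨D, hD, h1, h2, -⟩, ⟨D', hD', -, h2', h3'⟩, ⟨E, hE, k1, k2, k3⟩⟩
    exact h.not_one_mem_of_two_mem hC hx (hN D hD).1 (hN D hD).2.1 h1 h2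
      (hN D' hD').1 (hN D' hD').2.1 h2' h3' (hN E hE).1 k1 k2 k3
  · rintro ⟨⟨D, hD, -, h2, h3⟩, ⟨D', hD', h1', -, h3'⟩, ⟨E, hE, k1, k2, k3⟩⟩
    exact h.not_one_mem_of_two_mem hC hx.rotate (hN D hD).1 (hN D hD).2.1 h2 h3
      (hN D' hD').1 (hN D' hD').2.1 h3' h1' (hN E hE).1 k2 k3 k1
  · rintro ⟨⟨D, hD, h1, -, h3⟩, ⟨D', hD', h1', h2', -⟩, ⟨E, hE, k1, k2, k3⟩⟩
    exact h.not_one_mem_of_two_mem hC hx.rotate.rotate (hN D hD).1 (hN D hD).2.1 h3 h1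
      (hN D' hD').1 (hN D' hD').2.1 h1' h2' (hN E hE).1 k3 k1 k2

lemma exists_isHexagon (h : IsHexagonFamily F m 𝒞) (hne : ∀ S ∈ 𝒞, S.Nonempty) (hC : C ∈ 𝒞) :
    ∃ x y z, IsHexagon F m C x y z := by
  obtain ⟨v, hv⟩ := hne C hC
  exact ⟨v, h.hexagon hC hv⟩

lemma card_neighbors_le_four (h : IsHexagonFamily F m 𝒞) (hC : C ∈ 𝒞)
    (hx : IsHexagon F m C x y z) {N : Finset (Set V)} (hN : ∀ D ∈ N, IsNeighbor 𝒞 C D) :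
    N.card ≤ 4 := by
  classical
  rw [← h.card_image_pattern hC hx hN]
  exact (h.admissible_image_pattern hC hx hN).card_le_four _

lemma card_intersecting_neighbors_le_three (h : IsHexagonFamily F m 𝒞) (hC : C ∈ 𝒞)
    (hx : IsHexagon F m C x y z) {N : Finset (Set V)} (hN : ∀ D ∈ N, IsNeighbor 𝒞 C D)
    (hint : ∀ D ∈ N, ∀ E ∈ N, (D ∩ E).Nonempty) : N.card ≤ 3 := by
  classical
  have hint' : ∀ D ∈ N, ∀ E ∈ N, ¬ Disjoint D E := fun D hD E hE =>
    Set.not_disjoint_iff_nonempty_inter.2 (hint D hD E hE)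
  rw [← h.card_image_pattern hC hx hN]
  refine (h.admissible_image_pattern hC hx hN).card_le_three_of_no_complement _ ?_ ?_ ?_
  all_goals
    simp only [mem_image_pattern, Bool.false_eq_true, iff_false, iff_true]
    rintro ⟨⟨D, hD, h1, h2, h3⟩, ⟨E, hE, k1, k2, k3⟩⟩
    refine hint' D hD E hE ?_
  · exact h.disjoint_of_complementary hC hx (hN D hD).1 (hN D hD).2.1 h1 h2 (hN E hE).1 k1 k2 k3
  · exact h.disjoint_of_complementary hC hx.rotate (hN D hD).1 (hN D hD).2.1 h2 h3
      (hN E hE).1 k2 k3 k1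
  · exact h.disjoint_of_complementary hC hx.rotate.rotate (hN D hD).1 (hN D hD).2.1 h3 h1
      (hN E hE).1 k3 k1 k2

/-- If `D` shares an `F`-edge with `C` and hexagons meet `C` only in either of the two matching
edges next to it, then `D` has at most three neighbours. -/
lemma card_neighbors_le_three (h : IsHexagonFamily F m 𝒞) (hC : C ∈ 𝒞)
    (hx : IsHexagon F m C x y z)
    (hD : D ∈ 𝒞) (hne : D ≠ C) (hxD : x ∈ D) (hyD : y ∈ D)
    {E E' : Set V} (hE : E ∈ 𝒞) (hxE : x ∈ E) (hyE : y ∉ E) (hzE : z ∉ E)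
    (hE' : E' ∈ 𝒞) (hxE' : x ∉ E') (hyE' : y ∈ E') (hzE' : z ∉ E')
    {N : Finset (Set V)} (hN : ∀ A ∈ N, IsNeighbor 𝒞 D A) : N.card ≤ 3 := by
  classical
  obtain ⟨w, hw, hzD, hwC⟩ := h.exists_of_two_mem hC hx hD hne hxD hyD
  have hmwC : m w ∉ C := fun hh => hwC ((h.partner_mem_iff hC).1 hh)
  have hwE : w ∈ E := by
    obtain ⟨p, q, hp⟩ := h.hexagon hE hxE
    have hq : m q = m w := h.eq_of_adj hx.adj_zx.symm hp.adj_zx.symm hw.adj_zx.symm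
      (fun e => hzE ((h.partner_mem_iff hE).1 (e ▸ h.partner_mem hE hp.mem_right)))
      (fun e => hmwC (e ▸ h.partner_mem hC hx.mem_right))
    exact (h.partner_mem_iff hE).1 (hq ▸ h.partner_mem hE hp.mem_right)
  have hwE' : w ∈ E' := by
    obtain ⟨p, q, hp⟩ := h.hexagon hE' hyE'
    obtain rfl : p = w := h.eq_of_adj hx.adj_yz hp.adj_xy hw.adj_yz
      (fun e => hzE' (e ▸ hp.mem_mid)) (fun e => hwC (e ▸ hx.mem_right))
    exact hp.mem_mid
  have hN' : ∀ A ∈ insert C (insert E (insert E' N)), IsNeighbor 𝒞 D A := by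
    intro A hA
    simp only [Finset.mem_insert] at hA
    rcases hA with rfl | rfl | rfl | hA
    · exact ⟨hC, hne.symm, x, hx.mem_left, hxD⟩
    · exact ⟨hE, fun e => hyE (e ▸ hyD), x, hxE, hxD⟩
    · exact ⟨hE', fun e => hxE' (e ▸ hxD), y, hyE', hyD⟩
    · exact hN A hA
  calc N.card ≤ (insert C (insert E (insert E' N))).card :=
        Finset.card_le_card fun A hA => by simp [hA]
    _ ≤ 3 := by
        rw [← h.card_image_pattern hD hw hN']
        refine (h.admissible_image_pattern hD hw hN').card_le_three _ ?_ ?_ ?_ <;>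
          simp only [mem_image_pattern, Bool.false_eq_true, iff_false, iff_true]
        · exact ⟨C, by simp, hx.mem_left, hx.mem_mid, hwC⟩
        · exact ⟨E', by simp, hxE', hyE', hwE'⟩
        · exact ⟨E, by simp, hxE, hyE, hwE⟩

open Classical in
/-- Two disjoint members with two common neighbours have at most eight members in the union of
their closed neighbourhoods. -/
lemma card_closedNeighborhoods_le_eight (h : IsHexagonFamily F m 𝒞)
    (hne : ∀ S ∈ 𝒞, S.Nonempty) {𝒮 : Finset (Set V)} (h𝒮 : ∀ S ∈ 𝒮, S ∈ 𝒞)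
    {A B C D : Set V} (hA : A ∈ 𝒮) (hB : B ∈ 𝒮) (hC : C ∈ 𝒮) (hD : D ∈ 𝒮) (hCD : C ≠ D)
    (hCA : (C ∩ A).Nonempty) (hCB : (C ∩ B).Nonempty)
    (hDA : (D ∩ A).Nonempty) (hDB : (D ∩ B).Nonempty) :
    (𝒮.filter fun S => (S ∩ A).Nonempty ∨ (S ∩ B).Nonempty).card ≤ 8 := by
  have closed : ∀ A ∈ 𝒮, (𝒮.filter fun S => (S ∩ A).Nonempty).card ≤ 5 := by
    intro A hA
    obtain ⟨x, y, z, hx⟩ := h.exists_isHexagon hne (h𝒮 A hA)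
    have := h.card_neighbors_le_four (h𝒮 A hA) hx
      (N := (𝒮.filter fun S => (S ∩ A).Nonempty).erase A) (by
        intro S hS
        simp only [Finset.mem_erase, Finset.mem_filter] at hS
        exact ⟨h𝒮 S hS.2.1, hS.1, hS.2.2⟩)
    have := Finset.pred_card_le_card_erase (s := 𝒮.filter fun S => (S ∩ A).Nonempty) (a := A)
    omega
  have h2 : 2 ≤ ((𝒮.filter fun S => (S ∩ A).Nonempty) ∩
      (𝒮.filter fun S => (S ∩ B).Nonempty)).card := by
    rw [← Finset.card_pair hCD]
    refine Finset.card_le_card ?_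
    simp [Finset.insert_subset_iff, *]
  have := Finset.card_union_add_card_inter (𝒮.filter fun S => (S ∩ A).Nonempty)
    (𝒮.filter fun S => (S ∩ B).Nonempty)
  rw [Finset.filter_or]
  have := closed A hA
  have := closed B hB
  omega

open Classical in
/-- Every nonempty subfamily has a nonempty disjoint part whose closed neighbourhood is at most
four times as large. -/
lemma exists_disjoint_part (h : IsHexagonFamily F m 𝒞) (hne : ∀ S ∈ 𝒞, S.Nonempty)
    {𝒮 : Finset (Set V)} (h𝒮 : ∀ S ∈ 𝒮, S ∈ 𝒞) (hnon : 𝒮.Nonempty) :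
    ∃ I ⊆ 𝒮, I.Nonempty ∧ ((I : Set (Set V)).Pairwise Disjoint) ∧
      (𝒮.filter fun S => ∃ A ∈ I, (S ∩ A).Nonempty).card ≤ 4 * I.card := by
  by_cases hlow : ∃ A ∈ 𝒮, (𝒮.filter fun S => S ≠ A ∧ (S ∩ A).Nonempty).card ≤ 3
  · obtain ⟨A, hA, hcard⟩ := hlow
    refine ⟨{A}, by simpa using hA, by simp, by simp, ?_⟩
    have hsub : (𝒮.filter fun S => ∃ B ∈ ({A} : Finset (Set V)), (S ∩ B).Nonempty) ⊆
        insert A (𝒮.filter fun S => S ≠ A ∧ (S ∩ A).Nonempty) := by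
      intro S hS
      simp only [Finset.mem_filter, Finset.mem_singleton, exists_eq_left] at hS
      simp only [Finset.mem_insert, Finset.mem_filter]
      tauto
    have := Finset.card_le_card hsub
    have := Finset.card_insert_le A (𝒮.filter fun S => S ≠ A ∧ (S ∩ A).Nonempty)
    simp only [Finset.card_singleton]
    omega
  push Not at hlow
  obtain ⟨C, hC⟩ := hnon
  have hC' := h𝒮 C hC
  obtain ⟨x, y, z, hx⟩ := h.exists_isHexagon hne hC'
  have hnbr : ∀ A, ∀ D ∈ 𝒮.filter fun S => S ≠ A ∧ (S ∩ A).Nonempty, IsNeighbor 𝒞 A D := by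
    intro A D hD
    simp only [Finset.mem_filter] at hD
    exact ⟨h𝒮 D hD.1, hD.2⟩
  have hadm := h.admissible_image_pattern hC' hx (hnbr C)
  have hfour := hlow C hC
  rw [← h.card_image_pattern hC' hx (hnbr C)] at hfour
  have hcases := hadm.cases_of_four_le_card _ hfour
  simp only [mem_image_pattern, Bool.false_eq_true, iff_false, iff_true, Finset.mem_filter]
    at hcases
  have side : ∀ {x y z}, IsHexagon F m C x y z → ∀ {D E E'}, D ∈ 𝒮 → D ≠ C → x ∈ D → y ∈ D →
      E ∈ 𝒮 → x ∈ E → y ∉ E → z ∉ E → E' ∈ 𝒮 → x ∉ E' → y ∈ E' → z ∉ E' → False := by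
    intro x y z hx D E E' hD hDC hxD hyD hE hxE hyE hzE hE' hxE' hyE' hzE'
    have := h.card_neighbors_le_three hC' hx (h𝒮 D hD) hDC hxD hyD (h𝒮 E hE) hxE hyE hzE
      (h𝒮 E' hE') hxE' hyE' hzE' (hnbr D)
    have := hlow D hD
    omega
  have main : ∀ {x y z}, IsHexagon F m C x y z → ∀ {D D' E}, D ∈ 𝒮 → D ≠ C → x ∈ D → y ∈ D →
      D' ∈ 𝒮 → D' ≠ C → y ∈ D' → z ∈ D' → E ∈ 𝒮 → x ∉ E → y ∉ E → z ∈ E →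
      ∃ I ⊆ 𝒮, I.Nonempty ∧ ((I : Set (Set V)).Pairwise Disjoint) ∧
      (𝒮.filter fun S => ∃ A ∈ I, (S ∩ A).Nonempty).card ≤ 4 * I.card := by
    intro x y z hx D D' E hD hDC hxD hyD hD' hDC' hyD' hzD' hE hxE hyE hzE
    have hdis := h.disjoint_of_complementary hC' hx (h𝒮 D hD) hDC hxD hyD (h𝒮 E hE) hxE hyE hzE
    have hDE : D ≠ E := fun e => hxE (e ▸ hxD)
    refine ⟨{D, E}, by simp [Finset.insert_subset_iff, hD, hE], by simp, ?_, ?_⟩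
    · simp only [Finset.coe_insert, Finset.coe_singleton]
      exact Set.pairwise_pair_of_symm.2 fun _ => hdis
    · rw [Finset.card_pair hDE]
      simpa using h.card_closedNeighborhoods_le_eight hne h𝒮 hD hE hC hD' hDC'.symm
        ⟨x, hx.mem_left, hxD⟩ ⟨z, hx.mem_right, hzE⟩ ⟨y, hyD', hyD⟩ ⟨z, hzD', hzE⟩
  have hy := hx.rotate
  have hz := hy.rotate
  rcases hcases with
    ⟨⟨D, ⟨hD, hDC, -⟩, h1, h2, h3⟩, ⟨D', ⟨hD', hDC', -⟩, h1', h2', h3'⟩, ⟨E, ⟨hE, -⟩, k1, k2, k3⟩⟩ |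
    ⟨⟨D, ⟨hD, hDC, -⟩, h1, h2, h3⟩, ⟨D', ⟨hD', hDC', -⟩, h1', h2', h3'⟩, ⟨E, ⟨hE, -⟩, k1, k2, k3⟩⟩ |
    ⟨⟨D, ⟨hD, hDC, -⟩, h1, h2, h3⟩, ⟨D', ⟨hD', hDC', -⟩, h1', h2', h3'⟩, ⟨E, ⟨hE, -⟩, k1, k2, k3⟩⟩ |
    ⟨⟨D, ⟨hD, hDC, -⟩, h1, h2, h3⟩, ⟨D', ⟨hD', hDC', -⟩, h1', h2', h3'⟩, ⟨E, ⟨hE, -⟩, k1, k2, k3⟩⟩ |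
    ⟨⟨D, ⟨hD, hDC, -⟩, h1, h2, h3⟩, ⟨D', ⟨hD', hDC', -⟩, h1', h2', h3'⟩, ⟨E, ⟨hE, -⟩, k1, k2, k3⟩⟩ |
    ⟨⟨D, ⟨hD, hDC, -⟩, h1, h2, h3⟩, ⟨D', ⟨hD', hDC', -⟩, h1', h2', h3'⟩, ⟨E, ⟨hE, -⟩, k1, k2, k3⟩⟩
  · exact (side hx hD hDC h1 h2 hD' h1' h2' h3' hE k1 k2 k3).elim
  · exact (side hy hD hDC h2 h3 hD' h2' h3' h1' hE k2 k3 k1).elim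
  · exact (side hz hD hDC h3 h1 hD' h3' h1' h2' hE k3 k1 k2).elim
  · exact main hx hD hDC h1 h2 hD' hDC' h2' h3' hE k1 k2 k3
  · exact main hy hD hDC h2 h3 hD' hDC' h3' h1' hE k2 k3 k1
  · exact main hz hD hDC h3 h1 hD' hDC' h1' h2' hE k3 k1 k2

lemma exists_disjoint_subfamily (h : IsHexagonFamily F m 𝒞) (hne : ∀ S ∈ 𝒞, S.Nonempty)
    (𝒮 : Finset (Set V)) (h𝒮 : ∀ S ∈ 𝒮, S ∈ 𝒞) :
    ∃ I ⊆ 𝒮, ((I : Set (Set V)).Pairwise Disjoint) ∧ 𝒮.card ≤ 4 * I.card := by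
  classical
  induction 𝒮 using Finset.strongInduction with
  | H 𝒮 ih =>
    rcases 𝒮.eq_empty_or_nonempty with rfl | hnon
    · exact ⟨∅, by simp⟩
    obtain ⟨I, hI, ⟨A, hA⟩, hpair, hcard⟩ := h.exists_disjoint_part hne h𝒮 hnon
    have hAA : (A ∩ A).Nonempty := by simpa using hne A (h𝒮 A (hI hA))
    have hlt : (𝒮.filter fun S => ¬ ∃ A ∈ I, (S ∩ A).Nonempty) ⊂ 𝒮 :=
      Finset.filter_ssubset.2 ⟨A, hI hA, not_not.2 ⟨A, hA, hAA⟩⟩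
    obtain ⟨J, hJ, hJpair, hJcard⟩ := ih _ hlt fun S hS => h𝒮 S (Finset.filter_subset _ _ hS)
    have hcross : ∀ B ∈ I, ∀ S ∈ J, Disjoint B S := by
      intro B hB S hS
      have := (Finset.mem_filter.1 (hJ hS)).2
      by_contra hcon
      refine this ⟨B, hB, ?_⟩
      rw [Set.inter_comm]
      exact Set.not_disjoint_iff_nonempty_inter.1 hcon
    have hdisj : Disjoint I J := by
      rw [Finset.disjoint_left]
      intro B hB hBJ
      obtain ⟨v, hv⟩ := hne B (h𝒮 B (hI hB))
      exact Set.disjoint_left.1 (hcross B hB B hBJ) hv hv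
    refine ⟨I ∪ J, Finset.union_subset hI (hJ.trans (Finset.filter_subset _ _)), ?_, ?_⟩
    · rw [Finset.coe_union, Set.pairwise_union_of_symm]
      exact ⟨hpair, hJpair, fun B hB S hS _ => hcross B hB S hS⟩
    · rw [Finset.card_union_of_disjoint hdisj]
      have := Finset.card_filter_add_card_filter_not (s := 𝒮)
        (fun S => ∃ A ∈ I, (S ∩ A).Nonempty)
      omega

end IsHexagonFamily

end Hexagons

lemma length_le_ncard_of_nodup [Finite V] {S : Set V} {l : List V} (hl : l.Nodup)
    (hS : ∀ a ∈ l, a ∈ S) : l.length ≤ S.ncard := by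
  classical
  rw [← List.toFinset_card_of_nodup hl, ← Set.ncard_coe_finset]
  exact Set.ncard_le_ncard (by simpa [Set.subset_def] using hS) S.toFinite

lemma mem_of_nodup_of_ncard_le [Finite V] {S : Set V} {l : List V} (hl : l.Nodup)
    (hS : ∀ a ∈ l, a ∈ S) (hcard : S.ncard ≤ l.length) {v : V} (hv : v ∈ S) : v ∈ l := by
  by_contra hvl
  have := length_le_ncard_of_nodup (S := S) (List.nodup_cons.2 ⟨hvl, hl⟩) (by simpa [hv] using hS)
  simp only [List.length_cons] at this
  omega

/-- In a cubic graph, the complement of a 2-factor is a perfect matching. -/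
lemma exists_partner [Finite V] {G F : SimpleGraph V} (hcubic : IsCubic G)
    (h2f : Is2Factor G F) :
    ∃ m : V → V, ∀ v, G.Adj v (m v) ∧ ¬ F.Adj v (m v) ∧
      ∀ w, G.Adj v w → ¬ F.Adj v w → w = m v := by
  have key : ∀ v, ∃ w, G.neighborSet v \ F.neighborSet v = {w} := by
    intro v
    rw [← Set.ncard_eq_one, Set.ncard_sdiff (neighborSet_mono h2f.1 v) (Set.toFinite _)]
    have h3 : (G.neighborSet v).ncard = 3 := hcubic v
    have h2 : (F.neighborSet v).ncard = 2 := h2f.2 v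
    omega
  choose m hm using key
  refine ⟨m, fun v => ?_⟩
  have hmem : ∀ w, (G.Adj v w ∧ ¬ F.Adj v w) ↔ w = m v := fun w => by
    simpa using Set.ext_iff.1 (hm v) w
  exact ⟨((hmem _).2 rfl).1, ((hmem _).2 rfl).2, fun w h1 h2 => (hmem w).1 ⟨h1, h2⟩⟩

lemma Is2Factor.eq_of_adj [Finite V] {G F : SimpleGraph V} (h2f : Is2Factor G F) {v a b c : V}
    (ha : F.Adj v a) (hb : F.Adj v b) (hc : F.Adj v c) (hba : b ≠ a) (hca : c ≠ a) : b = c := by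
  by_contra hbc
  have hcard : (F.neighborSet v).ncard = 2 := h2f.2 v
  have := length_le_ncard_of_nodup (S := F.neighborSet v) (l := [a, b, c])
    (by simp [hbc, hba.symm, hca.symm]) (by simp [ha, hb, hc])
  simp only [List.length_cons, List.length_nil] at this
  omega

lemma IndepBoundary.edge_eq {G : SimpleGraph V} {S : Set V} (h : IndepBoundary G S)
    {u v w w' : V} (hu : u ∈ S) (hv : v ∈ S) (hw : w ∉ S) (hw' : w' ∉ S)
    (huw : G.Adj u w) (hvw : G.Adj v w') (hshare : u = v ∨ w = w') : u = v ∧ w = w' := by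
  have heq : s(u, w) = s(v, w') := by
    by_contra hne
    have hno := h ⟨u, w, rfl, huw, hu, hw⟩ ⟨v, w', rfl, hvw, hv, hw'⟩ hne
    rcases hshare with rfl | rfl
    · exact hno u (by simp) (by simp)
    · exact hno w (by simp) (by simp)
  rcases Sym2.eq_iff.1 heq with h | ⟨h1, h2⟩
  · exact h
  · exact absurd (h1 ▸ hu) hw'

section CstarSix

variable {G F : SimpleGraph V} {S : Set V}

lemma ncard_of_mem_Cstar6F (hS : S ∈ Cstar6F G F) : S.ncard = 6 := hS.1.1.1.2.1

lemma indepBoundary_of_mem_Cstar6F (hS : S ∈ Cstar6F G F) : IndepBoundary G S := hS.1.1.2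

lemma exists_inner_of_mem_Cstar6F (h2f : Is2Factor G F) (hS : S ∈ Cstar6F G F) {v : V}
    (hv : v ∈ S) : ∃ a ∈ S, F.Adj v a := by
  obtain ⟨p, q, hpq, heq⟩ := Set.ncard_eq_two.1 (h2f.2 v : (F.neighborSet v).ncard = 2)
  have hp : F.Adj v p := by simpa using (Set.ext_iff.1 heq p).2 (by simp)
  have hq : F.Adj v q := by simpa using (Set.ext_iff.1 heq q).2 (by simp)
  by_contra! hcon
  exact hpq ((indepBoundary_of_mem_Cstar6F hS).edge_eq hv hv (fun h => hcon p h hp)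
    (fun h => hcon q h hq) (h2f.1 hp) (h2f.1 hq) (Or.inl rfl)).2

variable [Finite V]

lemma exists_outer_of_mem_Cstar6F (hS : S ∈ Cstar6F G F) {v : V} (hv : v ∈ S) :
    ∃ w, w ∉ S ∧ F.Adj v w := by
  have hend : ∀ e : Sym2 V, ∃ u, e ∈ bdry G S ∩ F.edgeSet →
      u ∈ e ∧ u ∈ S ∧ ∃ w, w ∉ S ∧ F.Adj u w := by
    intro e
    by_cases he : e ∈ bdry G S ∩ F.edgeSet
    · obtain ⟨⟨u, w, rfl, -, hu, hw⟩, hF⟩ := he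
      exact ⟨u, fun _ => ⟨by simp, hu, w, hw, hF⟩⟩
    · exact ⟨v, fun h => absurd h he⟩
  choose g hg using hend
  have hle : (bdry G S ∩ F.edgeSet).ncard ≤ {u | u ∈ S ∧ ∃ w, w ∉ S ∧ F.Adj u w}.ncard := by
    refine Set.ncard_le_ncard_of_injOn g (fun e he => (hg e he).2) ?_ (Set.toFinite _)
    intro e he f hf hef
    by_contra hne
    exact indepBoundary_of_mem_Cstar6F hS he.1 hf.1 hne (g e) (hg e he).1 (hef ▸ (hg f hf).1)
  have hcard : (bdry G S ∩ F.edgeSet).ncard = 6 := hS.2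
  have heq := Set.eq_of_subset_of_ncard_le
    (s := {u | u ∈ S ∧ ∃ w, w ∉ S ∧ F.Adj u w}) (t := S) (fun u hu => hu.1)
    (by rw [ncard_of_mem_Cstar6F hS, ← hcard]; exact hle)
  exact ((Set.ext_iff.1 heq v).2 hv).2

lemma inner_unique_of_mem_Cstar6F (h2f : Is2Factor G F) (hS : S ∈ Cstar6F G F) {v a b : V}
    (hv : v ∈ S) (ha : a ∈ S) (hb : b ∈ S) (hva : F.Adj v a) (hvb : F.Adj v b) : a = b := by
  obtain ⟨w, hw, hvw⟩ := exists_outer_of_mem_Cstar6F hS hv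
  exact h2f.eq_of_adj hvw hva hvb (fun e => hw (e ▸ ha)) (fun e => hw (e ▸ hb))

/-- A square through an edge of `S` whose other two vertices lie outside `S` is an induced
4-circuit touching `S`. -/
lemma no_square_of_mem_Cstar6F (hS : S ∈ Cstar6F G F) {u v u' v' : V}
    (hu : u ∈ S) (hv : v ∈ S) (hu' : u' ∉ S) (hv' : v' ∉ S)
    (huv : G.Adj u v) (huu : G.Adj u u') (hvv : G.Adj v v') : ¬ G.Adj u' v' := by
  intro h'
  have hind := indepBoundary_of_mem_Cstar6F hS
  have huv' : ¬ G.Adj u v' := fun hh =>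
    h'.ne (hind.edge_eq hu hu hu' hv' huu hh (Or.inl rfl)).2
  have hvu' : ¬ G.Adj v u' := fun hh =>
    h'.ne (hind.edge_eq hv hv hu' hv' hh hvv (Or.inl rfl)).2
  have n1 := huv.ne
  have n2 := h'.ne
  have n3 : u ≠ u' := huu.ne
  have n4 : v ≠ v' := hvv.ne
  have n5 : u ≠ v' := fun e => hv' (e ▸ hu)
  have n6 : v ≠ u' := fun e => hu' (e ▸ hv)
  have hcyc : HasSpanningCycle G {u, v, v', u'} := by
    refine ⟨u, .cons huv (.cons hvv (.cons h'.symm (.cons huu.symm .nil))), ?_, ?_⟩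
    · rw [Walk.isCycle_def]
      refine ⟨?_, by simp, ?_⟩
      · rw [Walk.isTrail_def]
        simp only [Walk.edges_cons, Walk.edges_nil, List.nodup_cons, List.mem_cons,
          List.not_mem_nil, Sym2.eq_iff]
        grind
      · simp only [Walk.support_cons, Walk.support_nil, List.tail_cons, List.nodup_cons,
          List.mem_cons, List.not_mem_nil]
        grind
    · intro x
      simp only [Walk.support_cons, Walk.support_nil, List.mem_cons, List.not_mem_nil,
        Set.mem_insert_iff, Set.mem_singleton_iff]
      tauto
  have hcard : ({u, v, v', u'} : Set V).ncard = 4 := by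
    rw [Set.ncard_insert_of_notMem (by simp [n1, n3, n5]),
      Set.ncard_insert_of_notMem (by simp [n4, n6]), Set.ncard_pair n2.symm]
  have hedges : {e : Sym2 V | e ∈ G.edgeSet ∧ ∀ x ∈ e, x ∈ ({u, v, v', u'} : Set V)} =
      {s(u, v), s(v, v'), s(v', u'), s(u', u)} := by
    ext e
    induction e using Sym2.ind with
    | h a b =>
      simp only [Set.mem_ofPred_eq, mem_edgeSet, Sym2.mem_iff, forall_eq_or_imp, forall_eq,
        Set.mem_insert_iff, Set.mem_singleton_iff, Sym2.eq_iff]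
      constructor
      · rintro ⟨hab, ha, hb⟩
        rcases ha with rfl | rfl | rfl | rfl <;> rcases hb with rfl | rfl | rfl | rfl <;>
          first
          | exact absurd hab G.irrefl
          | exact absurd hab huv'
          | exact absurd hab.symm huv'
          | exact absurd hab hvu'
          | exact absurd hab.symm hvu'
          | simp
      · have := huv.symm
        have := huu.symm
        have := hvv.symm
        have := h'.symm
        rintro ((⟨rfl, rfl⟩ | ⟨rfl, rfl⟩) | (⟨rfl, rfl⟩ | ⟨rfl, rfl⟩) | (⟨rfl, rfl⟩ | ⟨rfl, rfl⟩) |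
          (⟨rfl, rfl⟩ | ⟨rfl, rfl⟩)) <;> simp [*]
  have hind4 : inducedEdges G {u, v, v', u'} = 4 := by
    change ({e : Sym2 V | e ∈ G.edgeSet ∧ ∀ x ∈ e, x ∈ ({u, v, v', u'} : Set V)}).ncard = 4
    rw [hedges, Set.ncard_insert_of_notMem (by simp; grind),
      Set.ncard_insert_of_notMem (by simp; grind), Set.ncard_pair (by simp; grind)]
  refine hS.1.2 ⟨{u, v, v', u'}, Or.inl ⟨hcyc, hcard, hind4⟩, ⟨u, hu, by simp⟩, ?_⟩
  by_contra hemp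
  have hsub : S ⊆ {u, v, v', u'} := by
    rwa [Set.not_nonempty_iff_eq_empty, Set.sdiff_eq_empty] at hemp
  have := Set.ncard_le_ncard hsub (Set.toFinite _)
  rw [hcard, ncard_of_mem_Cstar6F hS] at this
  omega

lemma exists_isHexagon_of_mem_Cstar6F (h2f : Is2Factor G F) {m : V → V}
    (hinv : ∀ v, m (m v) = v) (hmne : ∀ v, m v ≠ v) (hmF : ∀ v, ¬ F.Adj v (m v))
    (hS : S ∈ Cstar6F G F) (hmS : ∀ v ∈ S, m v ∈ S) {v : V} (hv : v ∈ S) :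
    ∃ y z, IsHexagon F m S v y z := by
  have hinner := fun {v a b} => inner_unique_of_mem_Cstar6F h2f hS (v := v) (a := a) (b := b)
  have hex := fun {v} => exists_inner_of_mem_Cstar6F h2f hS (v := v)
  have hcard := ncard_of_mem_Cstar6F hS
  have hmF' : ∀ v, ¬ F.Adj (m v) v := fun v h => hmF v h.symm
  obtain ⟨y, hy, hvy⟩ := hex (hmS v hv)
  obtain ⟨z, hz, hyz⟩ := hex (hmS y hy)
  obtain ⟨t, ht, hzt⟩ := hex (hmS z hz)
  have hmv := hmS v hv
  have hmy := hmS y hy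
  have hmz := hmS z hz
  have y0 : y ≠ v := by rintro rfl; exact hmF' _ hvy
  have y1 : y ≠ m v := hvy.ne'
  have z1 : z ≠ m v := fun e => hmne y (hinner hmv hmy hy (e ▸ hyz.symm) hvy)
  have z2 : z ≠ y := fun e => hmF' y (e ▸ hyz)
  have z3 : z ≠ m y := hyz.ne'
  have z0 : z ≠ v := by
    rintro rfl
    obtain ⟨p, hp, hpl⟩ : ∃ p ∈ S, p ∉ [z, m z, y, m y] := by
      by_contra! hcon
      have := Set.ncard_le_ncard (t := {z, m z, y, m y})
        (fun p hp => by simpa using hcon p hp) (Set.toFinite _)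
      have := Set.ncard_insert_le z {m z, y, m y}
      have := Set.ncard_insert_le (m z) {y, m y}
      have := Set.ncard_pair (hmne y).symm
      omega
    obtain ⟨q, hq, hpq⟩ := hex hp
    have hmp := hmS p hp
    have hpm : q ≠ m p := fun e => hmF p (e ▸ hpq)
    have hpq' := hpq.ne
    have := hmne p
    simp only [List.mem_cons, List.not_mem_nil, or_false, not_or] at hpl
    have q0 : q ≠ z := by
      rintro rfl
      exact hpl.2.2.2 (hinner hz hp hmy hpq.symm hyz.symm)
    have q1 : q ≠ m z := by
      rintro rfl
      exact hpl.2.2.1 (hinner hmv hp hy hpq.symm hvy)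
    have q2 : q ≠ y := by
      rintro rfl
      exact hpl.2.1 (hinner hy hp hmv hpq.symm hvy.symm)
    have q3 : q ≠ m y := by
      rintro rfl
      exact hpl.1 (hinner hmy hp hz hpq.symm hyz)
    have := length_le_ncard_of_nodup (S := S) (l := [z, m z, y, m y, p, m p, q])
      (by
        simp only [List.nodup_cons, List.mem_cons, List.not_mem_nil]
        grind) (by simp [*])
    simp only [List.length_cons, List.length_nil] at this
    omega
  have hnd : [v, m v, y, m y, z, m z].Nodup := by
    simp only [List.nodup_cons, List.mem_cons, List.not_mem_nil]
    grind
  have hmem : ∀ a ∈ S, a ∈ [v, m v, y, m y, z, m z] := fun a ha =>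
    mem_of_nodup_of_ncard_le hnd (by simp [*]) (by simp [hcard]) ha
  have htv : t = v := by
    have h0 := hmem t ht
    simp only [List.mem_cons, List.not_mem_nil, or_false] at h0
    rcases h0 with h0 | rfl | rfl | rfl | rfl | rfl
    · exact h0
    · have := hinner hmv hmz hy hzt.symm hvy
      grind
    · have := hinner hy hmz hmv hzt.symm hvy.symm
      grind
    · have := hinner hmy hmz hz hzt.symm hyz
      grind
    · exact absurd hzt (hmF' _)
    · exact absurd hzt F.irrefl
  refine ⟨y, z, ?_, hnd, hvy, hyz, htv ▸ hzt⟩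
  ext a
  constructor
  · intro ha
    simpa using hmem a ha
  · rintro (rfl | rfl | rfl | rfl | rfl | rfl) <;> assumption

lemma exists_isHexagonFamily_Cstar6F (hcubic : IsCubic G) (h2f : Is2Factor G F) :
    ∃ m : V → V, IsHexagonFamily F m (Cstar6F G F) := by
  obtain ⟨m, hm⟩ := exists_partner hcubic h2f
  have hinv : ∀ v, m (m v) = v := fun v =>
    ((hm (m v)).2.2 v (hm v).1.symm fun h => (hm v).2.1 h.symm).symm
  have hmem : ∀ {S}, S ∈ Cstar6F G F → ∀ v ∈ S, m v ∈ S := by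
    intro S hS v hv
    by_contra hmv
    obtain ⟨w, hw, hvw⟩ := exists_outer_of_mem_Cstar6F hS hv
    have := ((indepBoundary_of_mem_Cstar6F hS).edge_eq hv hv hw hmv (h2f.1 hvw) (hm v).1
      (Or.inl rfl)).2
    exact (hm v).2.1 (this ▸ hvw)
  exact ⟨m, {
    invol := hinv
    eq_of_adj := h2f.eq_of_adj
    partner_mem := fun hS _ hv => hmem hS _ hv
    inner := fun hS _ _ _ => inner_unique_of_mem_Cstar6F h2f hS
    outer := fun hS _ _ _ hu hv hw huw hvw => ((indepBoundary_of_mem_Cstar6F hS).edge_eq hu hv hw hw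
      (h2f.1 huw) (h2f.1 hvw) (Or.inr rfl)).1
    no_square := fun hS _ _ _ _ hu hv hu' hv' huv huu hvv h => no_square_of_mem_Cstar6F hS hu hv
      hu' hv' (h2f.1 huv) (h2f.1 huu) (h2f.1 hvv) (h2f.1 h)
    hexagon := fun hS _ hv => exists_isHexagon_of_mem_Cstar6F h2f hinv (fun v => (hm v).1.ne')
      (fun v => (hm v).2.1) hS (hmem hS) hv }⟩

end CstarSix

/-- Any circuit in `C*₆` intersects at most 4 other circuits of `C*₆`, there are no 5
pairwise intersecting circuits in `C*₆`, and hence some pairwise disjoint subfamily has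
size at least `|C*₆|/4`. -/
theorem cstar6_disjoint_subfamily {V : Type*} [Fintype V] (G F : SimpleGraph V)
    (hcubic : IsCubic G) (hbridgeless : Bridgeless G) (h2f : Is2Factor G F) :
    (∀ C ∈ Cstar6F G F,
      Nat.card {C' : Set V // C' ∈ Cstar6F G F ∧ C' ≠ C ∧ (C' ∩ C).Nonempty} ≤ 4) ∧
    (¬ ∃ f : Fin 5 → Set V, Function.Injective f ∧ (∀ i, f i ∈ Cstar6F G F) ∧
      ∀ i j : Fin 5, (f i ∩ f j).Nonempty) ∧
    ∃ D : Set (Set V), D ⊆ Cstar6F G F ∧ (D.Pairwise fun A B => Disjoint A B) ∧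
      Nat.card ↥(Cstar6F G F) ≤ 4 * Nat.card ↥D := by
  classical
  obtain ⟨m, h⟩ := exists_isHexagonFamily_Cstar6F hcubic h2f
  have hne : ∀ S ∈ Cstar6F G F, S.Nonempty := fun S hS =>
    Set.nonempty_of_ncard_ne_zero (by rw [ncard_of_mem_Cstar6F hS]; norm_num)
  refine ⟨fun C hC => ?_, ?_, ?_⟩
  · obtain ⟨x, y, z, hx⟩ := h.exists_isHexagon hne hC
    rw [Nat.card_eq_fintype_card, Fintype.card_subtype]
    exact h.card_neighbors_le_four hC hx fun D hD => (Finset.mem_filter.1 hD).2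
  · rintro ⟨f, hinj, hmem, hint⟩
    obtain ⟨x, y, z, hx⟩ := h.exists_isHexagon hne (hmem 0)
    have hle := h.card_intersecting_neighbors_le_three (hmem 0) hx
      (N := (Finset.univ.erase 0).image f)
      (by
        intro D hD
        obtain ⟨i, hi, rfl⟩ := Finset.mem_image.1 hD
        exact ⟨hmem i, fun e => (Finset.mem_erase.1 hi).1 (hinj e), hint i 0⟩)
      (by
        intro D hD E hE
        obtain ⟨i, -, rfl⟩ := Finset.mem_image.1 hD
        obtain ⟨j, -, rfl⟩ := Finset.mem_image.1 hE
        exact hint i j)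
    rw [Finset.card_image_of_injective _ hinj] at hle
    simp at hle
  · obtain ⟨I, hI, hpair, hcard⟩ := h.exists_disjoint_subfamily hne (Cstar6F G F).toFinset
      (fun S hS => by simpa using hS)
    refine ⟨I, fun S hS => by simpa using hI hS, hpair, ?_⟩
    rw [Nat.card_coe_set_eq, Nat.card_coe_set_eq, Set.ncard_coe_finset,
      Set.ncard_eq_toFinset_card']
    exact hcard
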